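/- arXiv:1202.2783 — 11 statements merged into one kernel-verified Lean document; each statement's English description precedes it below -/
import Mathlib

section
/- Let Π(n) = (n/30)·(32·sin(π/n) + 4·tan(π/n) − 3·sin(2π/n)). Then for every natural number n ≥ 32, the relative error satisfies (1/105)·(π/n)^6 < (Π(n) − π)/π < (10/1047)·(π/n)^6. -/
open Real

noncomputable def chPi (n : ℕ) : ℝ :=
  (n / 30) * (32 * Real.sin (π / n) + 4 * Real.tan (π / n) - 3 * Real.sin (2 * π / n))

theorem pos_of_hasDerivAt_pos {f f' : ℝ → ℝ} {b : ℝ} (hb : 0 < b) (h0 : f 0 = 0)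
    (hd : ∀ x ∈ Set.Icc 0 b, HasDerivAt f (f' x) x) (hpos : ∀ x ∈ Set.Ioo 0 b, 0 < f' x) :
    0 < f b := by
  obtain ⟨c, hc, h⟩ := exists_hasDerivAt_eq_slope f f' hb
    (fun x hx => (hd x hx).continuousAt.continuousWithinAt)
    (fun x hx => hd x (Set.Ioo_subset_Icc_self hx))
  have hc' := hpos c hc
  rw [h, h0, sub_zero, sub_zero] at hc'
  exact (div_pos_iff_of_pos_right hb).1 hc'

theorem cos_lt_taylor_four {x : ℝ} (hx : 0 < x) :
    Real.cos x < 1 - x ^ 2 / 2 + x ^ 4 / 24 := by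
  have h := pos_of_hasDerivAt_pos (f := fun x => 1 - x ^ 2 / 2 + x ^ 4 / 24 - Real.cos x)
    (f' := fun x => Real.sin x - (x - x ^ 3 / 6)) hx (by simp)
    (fun y _ => by
      convert! ((((hasDerivAt_id y).pow 2).div_const 2).const_sub 1).add
        (((hasDerivAt_id y).pow 4).div_const 24) |>.sub (Real.hasDerivAt_cos y) using 1
      simp; ring)
    (fun y hy => by linarith [Real.sin_gt_sub_cube hy.1])
  linarith

theorem sin_lt_taylor_five {x : ℝ} (hx : 0 < x) :
    Real.sin x < x - x ^ 3 / 6 + x ^ 5 / 120 := by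
  have h := pos_of_hasDerivAt_pos (f := fun x => x - x ^ 3 / 6 + x ^ 5 / 120 - Real.sin x)
    (f' := fun x => 1 - x ^ 2 / 2 + x ^ 4 / 24 - Real.cos x) hx (by simp)
    (fun y _ => by
      convert! ((hasDerivAt_id y).sub (((hasDerivAt_id y).pow 3).div_const 6)).add
        (((hasDerivAt_id y).pow 5).div_const 120) |>.sub (Real.hasDerivAt_sin y) using 1
      simp; ring)
    (fun y hy => by linarith [cos_lt_taylor_four hy.1])
  linarith

theorem taylor_six_lt_cos {x : ℝ} (hx : 0 < x) :
    1 - x ^ 2 / 2 + x ^ 4 / 24 - x ^ 6 / 720 < Real.cos x := by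
  have h := pos_of_hasDerivAt_pos
    (f := fun x => Real.cos x - (1 - x ^ 2 / 2 + x ^ 4 / 24 - x ^ 6 / 720))
    (f' := fun x => x - x ^ 3 / 6 + x ^ 5 / 120 - Real.sin x) hx (by simp)
    (fun y _ => by
      convert! (Real.hasDerivAt_cos y).sub
        (((((hasDerivAt_id y).pow 2).div_const 2).const_sub 1).add
        (((hasDerivAt_id y).pow 4).div_const 24) |>.sub
        (((hasDerivAt_id y).pow 6).div_const 720)) using 1
      simp; ring)
    (fun y hy => by linarith [sin_lt_taylor_five hy.1])
  linarith

/-- The derivative of `32 sin x + 4 tan x - 3 sin 2x - 30 x` factors in terms of `cos x`. -/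
theorem hasDerivAt_chakrabartiHudson {x : ℝ} (hx : Real.cos x ≠ 0) :
    HasDerivAt (fun x => 32 * Real.sin x + 4 * Real.tan x - 3 * Real.sin (2 * x) - 30 * x)
      (4 * (1 - Real.cos x) ^ 3 * (3 * Real.cos x + 1) / Real.cos x ^ 2) x := by
  have h2 : HasDerivAt (fun x : ℝ => 2 * x) 2 x := by
    simpa using (hasDerivAt_id x).const_mul 2
  have h30 : HasDerivAt (fun x : ℝ => 30 * x) 30 x := by
    simpa using (hasDerivAt_id x).const_mul 30
  convert! ((((Real.hasDerivAt_sin x).const_mul 32).add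
    ((Real.hasDerivAt_tan hx).const_mul 4)).sub (h2.sin.const_mul 3)).sub h30 using 1
  rw [Real.cos_two_mul]
  field_simp
  ring

theorem two_mul_pow_six_lt_deriv {x : ℝ} (hx : 0 < x) (hx1 : x < 1 / 10) :
    2 * x ^ 6 < 4 * (1 - Real.cos x) ^ 3 * (3 * Real.cos x + 1) / Real.cos x ^ 2 := by
  have hc := cos_lt_taylor_four hx
  have hc2 := Real.one_sub_sq_div_two_le_cos (x := x)
  obtain ⟨u, hu⟩ : ∃ u, Real.cos x = 1 - u := ⟨1 - Real.cos x, by ring⟩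
  rw [hu] at hc hc2 ⊢
  obtain ⟨y, hy⟩ : ∃ y, y = x ^ 2 := ⟨_, rfl⟩
  have hy0 : 0 < y := by rw [hy]; positivity
  have hy1 : y < 1 / 100 := by rw [hy]; nlinarith
  rw [show x ^ 4 = y ^ 2 by rw [hy]; ring, ← hy] at hc
  rw [← hy] at hc2
  rw [show x ^ 6 = y ^ 3 by rw [hy]; ring, lt_div_iff₀ (by nlinarith)]
  have hl : y / 2 * (1 - y / 12) < u := by linarith
  have h3 : (y / 2 * (1 - y / 12)) ^ 3 < u ^ 3 :=
    pow_lt_pow_left₀ hl (by nlinarith) (by norm_num)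
  have h4 : y ^ 3 / 8 * (1 - y / 4) ≤ u ^ 3 := by
    refine le_trans ?_ h3.le
    have : 1 - y / 4 ≤ (1 - y / 12) ^ 3 := by nlinarith [sq_nonneg y]
    calc y ^ 3 / 8 * (1 - y / 4) ≤ y ^ 3 / 8 * (1 - y / 12) ^ 3 := by gcongr
      _ = _ := by ring
  have h5 : 4 * (1 - u) ^ 2 < (1 - y / 4) * (4 - 3 * u) := by nlinarith
  calc 2 * y ^ 3 * (1 - u) ^ 2 = y ^ 3 / 2 * (4 * (1 - u) ^ 2) := by ring
    _ < y ^ 3 / 2 * ((1 - y / 4) * (4 - 3 * u)) := by gcongr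
    _ = 4 * (y ^ 3 / 8 * (1 - y / 4)) * (4 - 3 * u) := by ring
    _ ≤ 4 * u ^ 3 * (4 - 3 * u) := by gcongr; linarith
    _ = _ := by ring

theorem deriv_lt_taylor_ten {x : ℝ} (hx : 0 < x) (hx1 : x < 1 / 10) :
    4 * (1 - Real.cos x) ^ 3 * (3 * Real.cos x + 1) / Real.cos x ^ 2 <
      2 * x ^ 6 + 3 / 4 * x ^ 8 + 11 / 10 * x ^ 10 := by
  have hc := taylor_six_lt_cos hx
  have hc2 := Real.cos_le_one x
  obtain ⟨u, hu⟩ : ∃ u, Real.cos x = 1 - u := ⟨1 - Real.cos x, by ring⟩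
  rw [hu] at hc hc2 ⊢
  obtain ⟨y, hy⟩ : ∃ y, y = x ^ 2 := ⟨_, rfl⟩
  have hy0 : 0 < y := by rw [hy]; positivity
  have hy1 : y < 1 / 100 := by rw [hy]; nlinarith
  rw [show x ^ 4 = y ^ 2 by rw [hy]; ring, show x ^ 6 = y ^ 3 by rw [hy]; ring, ← hy] at hc
  rw [show x ^ 6 = y ^ 3 by rw [hy]; ring, show x ^ 8 = y ^ 4 by rw [hy]; ring,
    show x ^ 10 = y ^ 5 by rw [hy]; ring]
  obtain ⟨v, hv⟩ : ∃ v, v = 1 - y / 12 + y ^ 2 / 360 := ⟨_, rfl⟩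
  have hv1 : v ≤ 1 := by rw [hv]; nlinarith
  have hv0 : 0 < v := by rw [hv]; nlinarith
  have hl : u < y / 2 * v := by rw [hv]; linarith
  have hu0 : 0 ≤ u := by linarith
  have hu1 : u < 1 / 200 := by nlinarith
  rw [div_lt_iff₀ (by nlinarith)]
  have h3 : u ^ 3 ≤ (y / 2 * v) ^ 3 := by gcongr
  have hv3 : v ^ 3 ≤ 1 - y / 4 + y ^ 2 / 30 := by
    have e : 1 - y / 4 + y ^ 2 / 30 - v ^ 3 =
        y ^ 2 * (1 / 240 + 17 * y / 8640 - 7 * y ^ 2 / 86400 + y ^ 3 / 518400 * (1 - y / 90)) := by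
      rw [hv]; ring
    have h1 : 0 ≤ y ^ 3 / 518400 * (1 - y / 90) := mul_nonneg (by positivity) (by linarith)
    have : 0 ≤
        y ^ 2 * (1 / 240 + 17 * y / 8640 - 7 * y ^ 2 / 86400 + y ^ 3 / 518400 * (1 - y / 90)) :=
      mul_nonneg (by positivity) (by nlinarith)
    linarith
  obtain ⟨w, hw⟩ : ∃ w, w = y / 2 - y ^ 2 / 25 := ⟨_, rfl⟩
  have huw : u < w := by
    rw [hw]
    rw [hv] at hl
    nlinarith [pow_pos hy0 2]
  have hw1 : w < 1 / 200 := by rw [hw]; nlinarith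
  have hww : (1 - y / 4 + y ^ 2 / 30) * (4 - 3 * w) / 2 <
      (2 + 3 / 4 * y + 11 / 10 * y ^ 2) * (1 - w) ^ 2 := by
    have e : (2 + 3 / 4 * y + 11 / 10 * y ^ 2) * (1 - w) ^ 2 -
        (1 - y / 4 + y ^ 2 / 30) * (4 - 3 * w) / 2 =
        y ^ 2 * (167 / 240 - 357 / 400 * y + 1671 / 5000 * y ^ 2 -
          107 / 2500 * y ^ 3 + 11 / 6250 * y ^ 4) := by
      rw [hw]; ring
    have : 0 <
        y ^ 2 * (167 / 240 - 357 / 400 * y + 1671 / 5000 * y ^ 2 -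
          107 / 2500 * y ^ 3 + 11 / 6250 * y ^ 4) := by
      have h3 : y ^ 3 < 1 / 100 := by nlinarith [pow_pos hy0 2]
      have := pow_pos hy0 2
      have := pow_pos hy0 4
      exact mul_pos (by positivity) (by linarith)
    linarith
  have hA : 2 ≤ 2 + 3 / 4 * y + 11 / 10 * y ^ 2 := by nlinarith
  have hW : 1 - y / 4 + y ^ 2 / 30 ≤ 1 := by nlinarith
  have huu : (1 - y / 4 + y ^ 2 / 30) * (4 - 3 * u) / 2 <
      (2 + 3 / 4 * y + 11 / 10 * y ^ 2) * (1 - u) ^ 2 := by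
    have h1 := mul_le_mul_of_nonneg_right hA
      (mul_nonneg (sub_nonneg.2 huw.le) (by linarith : (0 : ℝ) ≤ 2 - u - w))
    have h2 := mul_le_mul_of_nonneg_right hW (sub_nonneg.2 huw.le)
    have h4 : 0 ≤ (w - u) * (2 - u - w - 1) :=
      mul_nonneg (sub_nonneg.2 huw.le) (by linarith)
    linarith
  calc 4 * (1 - (1 - u)) ^ 3 * (3 * (1 - u) + 1) = 4 * u ^ 3 * (4 - 3 * u) := by ring
    _ ≤ 4 * (y / 2 * v) ^ 3 * (4 - 3 * u) := by gcongr; linarith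
    _ = y ^ 3 / 2 * (v ^ 3 * (4 - 3 * u)) := by ring
    _ ≤ y ^ 3 / 2 * ((1 - y / 4 + y ^ 2 / 30) * (4 - 3 * u)) := by gcongr; linarith
    _ = y ^ 3 * ((1 - y / 4 + y ^ 2 / 30) * (4 - 3 * u) / 2) := by ring
    _ < y ^ 3 * ((2 + 3 / 4 * y + 11 / 10 * y ^ 2) * (1 - u) ^ 2) := by gcongr
    _ = _ := by ring

theorem lower_lt_chakrabartiHudson {x : ℝ} (hx : 0 < x) (hx1 : x < 1 / 10) :
    2 / 7 * x ^ 7 < 32 * Real.sin x + 4 * Real.tan x - 3 * Real.sin (2 * x) - 30 * x := by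
  have h := pos_of_hasDerivAt_pos (f := fun x =>
      32 * Real.sin x + 4 * Real.tan x - 3 * Real.sin (2 * x) - 30 * x - 2 / 7 * x ^ 7)
    (f' := fun x => 4 * (1 - Real.cos x) ^ 3 * (3 * Real.cos x + 1) / Real.cos x ^ 2 - 2 * x ^ 6)
    hx (by simp)
    (fun y hy => by
      have hc : Real.cos y ≠ 0 := by
        have := Real.one_sub_sq_div_two_le_cos (x := y)
        nlinarith [hy.1, hy.2]
      convert! (hasDerivAt_chakrabartiHudson hc).sub ((hasDerivAt_pow 7 y).const_mul (2 / 7)) using 1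
      norm_num; ring)
    (fun y hy => by linarith [two_mul_pow_six_lt_deriv hy.1 (hy.2.trans hx1)])
  linarith

theorem chakrabartiHudson_lt_upper {x : ℝ} (hx : 0 < x) (hx1 : x < 1 / 10) :
    32 * Real.sin x + 4 * Real.tan x - 3 * Real.sin (2 * x) - 30 * x <
      2 / 7 * x ^ 7 + 1 / 12 * x ^ 9 + 1 / 10 * x ^ 11 := by
  have h := pos_of_hasDerivAt_pos (f := fun x =>
      2 / 7 * x ^ 7 + 1 / 12 * x ^ 9 + 1 / 10 * x ^ 11 -
        (32 * Real.sin x + 4 * Real.tan x - 3 * Real.sin (2 * x) - 30 * x))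
    (f' := fun x => 2 * x ^ 6 + 3 / 4 * x ^ 8 + 11 / 10 * x ^ 10 -
      4 * (1 - Real.cos x) ^ 3 * (3 * Real.cos x + 1) / Real.cos x ^ 2)
    hx (by simp)
    (fun y hy => by
      have hc : Real.cos y ≠ 0 := by
        have := Real.one_sub_sq_div_two_le_cos (x := y)
        nlinarith [hy.1, hy.2]
      convert! ((((hasDerivAt_pow 7 y).const_mul (2 / 7)).add
        ((hasDerivAt_pow 9 y).const_mul (1 / 12))).add
        ((hasDerivAt_pow 11 y).const_mul (1 / 10))).sub (hasDerivAt_chakrabartiHudson hc) using 1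
      norm_num; ring)
    (fun y hy => by linarith [deriv_lt_taylor_ten hy.1 (hy.2.trans hx1)])
  linarith

theorem stmt_0 (n : ℕ) (hn : 32 ≤ n) :
    (1 / 105) * (π / n) ^ 6 < (chPi n - π) / π ∧
    (chPi n - π) / π < (10 / 1047) * (π / n) ^ 6 := by
  have hn0 : (0 : ℝ) < n := by exact_mod_cast (by omega : 0 < n)
  have hn32 : (32 : ℝ) ≤ n := by exact_mod_cast hn
  obtain ⟨x, hx⟩ : ∃ x, x = π / n := ⟨_, rfl⟩
  have hx0 : 0 < x := by rw [hx]; positivity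
  have hπ : π = n * x := by rw [hx]; field_simp
  have hx2 : x < 3.1416 / 32 := by
    rw [hx, div_lt_iff₀ hn0]
    nlinarith [Real.pi_lt_d4]
  have hx1 : x < 1 / 10 := by linarith
  have e : (chPi n - π) / π =
      (32 * Real.sin x + 4 * Real.tan x - 3 * Real.sin (2 * x) - 30 * x) / (30 * x) := by
    rw [chPi, mul_div_assoc 2 π (n : ℝ), ← hx]
    nth_rewrite 1 [hπ]
    nth_rewrite 1 [hπ]
    field_simp
  have hl := lower_lt_chakrabartiHudson hx0 hx1
  have hu := chakrabartiHudson_lt_upper hx0 hx1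
  rw [e, ← hx, lt_div_iff₀ (by positivity), div_lt_iff₀ (by positivity)]
  refine ⟨by linarith, hu.trans ?_⟩
  have hy : x ^ 2 < 9639 / 1000000 := by nlinarith
  have h4 : 1 / 12 * x ^ 2 + 1 / 10 * (x ^ 2) ^ 2 < 300 / 1047 - 2 / 7 := by
    nlinarith [sq_nonneg x]
  have := mul_lt_mul_of_pos_left h4 (pow_pos hx0 7)
  linarith
end

section
/- Let Π(n) = (n/30)·(32·sin(π/n) + 4·tan(π/n) − 3·sin(2π/n)). Then for every natural number n ≥ 32, Π(n) > π; that is, the Chakrabarti–Hudson approximation is in excess. -/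
open Real

theorem hasDerivAt_sin_tan_combination {x : ℝ} (hx : cos x ≠ 0) :
    HasDerivAt (fun y => 32 * sin y + 4 * tan y - 3 * sin (2 * y) - 30 * y)
      (4 * (1 - cos x) ^ 3 * (3 * cos x + 1) / cos x ^ 2) x := by
  have h₂ : HasDerivAt (fun y => sin (2 * y)) (cos (2 * x) * (2 * 1)) x :=
    ((hasDerivAt_id x).const_mul 2).sin
  convert! ((((hasDerivAt_sin x).const_mul 32).add ((hasDerivAt_tan hx).const_mul 4)).sub
    (h₂.const_mul 3)).sub ((hasDerivAt_id x).const_mul 30) using 1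
  rw [cos_two_mul]
  field_simp
  ring

theorem strictMonoOn_sin_tan_combination :
    StrictMonoOn (fun y => 32 * sin y + 4 * tan y - 3 * sin (2 * y) - 30 * y)
      (Set.Ico 0 (π / 2)) := by
  have hcos {x : ℝ} (hx : x ∈ Set.Ico 0 (π / 2)) : 0 < cos x :=
    cos_pos_of_mem_Ioo ⟨by linarith [hx.1, pi_pos], hx.2⟩
  refine strictMonoOn_of_deriv_pos (convex_Ico _ _) (fun x hx =>
    (hasDerivAt_sin_tan_combination (hcos hx).ne').continuousAt.continuousWithinAt)
    fun x hx => ?_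
  rw [interior_Ico] at hx
  have hc := hcos (Set.Ioo_subset_Ico_self hx)
  have hc₁ : 0 < 1 - cos x := by
    have := cos_lt_cos_of_nonneg_of_le_pi_div_two le_rfl hx.2.le hx.1
    rw [cos_zero] at this
    linarith
  rw [(hasDerivAt_sin_tan_combination hc.ne').deriv]
  positivity

theorem stmt_1 (n : ℕ) (hn : 32 ≤ n) : chPi n > π := by
  have hn' : (32 : ℝ) ≤ n := by exact_mod_cast hn
  have hpos : (0 : ℝ) < n := by linarith
  have hx : 0 < π / n := by positivity
  have hx' : π / n < π / 2 := div_lt_div_of_pos_left pi_pos two_pos (by linarith)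
  have h := strictMonoOn_sin_tan_combination ⟨le_rfl, by positivity⟩ ⟨hx.le, hx'⟩ hx
  simp only [sin_zero, tan_zero, mul_zero, add_zero, sub_zero] at h
  rw [← mul_div_assoc] at h
  calc π = (n / 30) * (30 * (π / n)) := by field_simp
    _ < chPi n := mul_lt_mul_of_pos_left (by linarith) (by positivity)
end

section
/- Let f(x) = (π/(30x))·(32·sin x + 4·tan x − 3·sin(2x)). Then the limit as x tends to 0 from the right of (f(x)/π − 1)/x^6 equals 1/105; consequently the constant 1/105 in the lower bound (1/105)·x^6 < f(x)/π − 1 is the best possible. -/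
open Real Filter

noncomputable def chF (x : ℝ) : ℝ :=
  (π / (30 * x)) * (32 * Real.sin x + 4 * Real.tan x - 3 * Real.sin (2 * x))

/-- The seventh-order Taylor remainder of `sin` at `0` is `o(x ^ 7)`. -/
theorem tendsto_sin_taylor_remainder :
    Tendsto (fun x : ℝ =>
      (Real.sin x - (x - x ^ 3 / 6 + x ^ 5 / 120 - x ^ 7 / 5040)) / x ^ 7) (nhds 0) (nhds 0) := by
  have h := Real.taylor_tendsto (n := 7) convex_univ (Set.mem_univ (0 : ℝ))
    Real.contDiff_sin.contDiffOn
  rw [nhdsWithin_univ] at h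
  refine h.congr fun x => ?_
  simp [taylor_within_apply, iteratedDerivWithin_univ, Nat.factorial]
  ring

/-- The sixth-order Taylor remainder of `cos` at `0` is `o(x ^ 6)`. -/
theorem tendsto_cos_taylor_remainder :
    Tendsto (fun x : ℝ =>
      (Real.cos x - (1 - x ^ 2 / 2 + x ^ 4 / 24 - x ^ 6 / 720)) / x ^ 6) (nhds 0) (nhds 0) := by
  have h := Real.taylor_tendsto (n := 6) convex_univ (Set.mem_univ (0 : ℝ))
    Real.contDiff_cos.contDiffOn
  rw [nhdsWithin_univ] at h
  refine h.congr fun x => ?_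
  simp [taylor_within_apply, iteratedDerivWithin_univ, Nat.factorial]
  ring

theorem chF_div_pi_sub_one {x : ℝ} (hx : x ≠ 0) (hcos : Real.cos x ≠ 0) :
    chF x / π - 1 = (16 * Real.sin (2 * x) + 5 / 2 * Real.sin x - 3 / 2 * Real.sin (3 * x)
      - 30 * (x * Real.cos x)) / (30 * x * Real.cos x) := by
  rw [chF, Real.tan_eq_sin_div_cos, Real.sin_three_mul, Real.sin_two_mul]
  field_simp
  rw [Real.sin_sq]
  ring

theorem stmt_2 :
    Filter.Tendsto (fun x : ℝ => (chF x / π - 1) / x ^ 6)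
      (nhdsWithin 0 (Set.Ioi 0)) (nhds (1 / 105)) := by
  have hmul (c : ℝ) : Tendsto (fun x : ℝ => c * x) (nhds 0) (nhds 0) :=
    Continuous.tendsto' (by fun_prop) _ _ (mul_zero c)
  have hcos : Tendsto Real.cos (nhds 0) (nhds 1) := by
    simpa using Real.continuous_cos.tendsto 0
  have hlim := ((((((tendsto_sin_taylor_remainder.comp (hmul 2)).const_mul (16 * 2 ^ 7)).add
    (tendsto_sin_taylor_remainder.const_mul (5 / 2))).sub
    ((tendsto_sin_taylor_remainder.comp (hmul 3)).const_mul (3 / 2 * 3 ^ 7))).sub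
    (tendsto_cos_taylor_remainder.const_mul 30)).const_add (2 / 7)).div
    (hcos.const_mul 30) (by norm_num)
  have hval : (2 / 7 + (16 * 2 ^ 7 * 0 + 5 / 2 * 0 - 3 / 2 * 3 ^ 7 * 0 - 30 * 0)) / (30 * 1)
      = (1 / 105 : ℝ) := by norm_num
  rw [hval] at hlim
  refine (hlim.mono_left nhdsWithin_le_nhds).congr' ?_
  have hcos_ne : ∀ᶠ x in nhdsWithin (0 : ℝ) (Set.Ioi 0), Real.cos x ≠ 0 :=
    (hcos.mono_left nhdsWithin_le_nhds).eventually_ne one_ne_zero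
  filter_upwards [hcos_ne, self_mem_nhdsWithin] with x hc hx
  have hx0 : x ≠ 0 := ne_of_gt hx
  rw [chF_div_pi_sub_one hx0 hc]
  simp only [Pi.div_apply, Function.comp_apply]
  field_simp
  ring
end

section
/- For all real x with 0 < x ≤ π/32, (15·cos x)/(2 + 16·cos x − 3·cos^2 x) < (sin x)/x; that is, the rational trigonometric approximation to sin x / x arising from the Chakrabarti–Hudson formula is in defect. -/
open Real

theorem hasDerivAt_two_mul_tan_add_sin_sub {x : ℝ} (hx : Real.cos x ≠ 0) :
    HasDerivAt (fun y : ℝ => 2 * Real.tan y + 16 * Real.sin y - 3 * (Real.sin y * Real.cos y)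
      - 15 * y) (2 * (1 - Real.cos x) ^ 3 * (3 * Real.cos x + 1) / Real.cos x ^ 2) x := by
  have h := ((((Real.hasDerivAt_tan hx).const_mul 2).add
    ((Real.hasDerivAt_sin x).const_mul 16)).sub
    (((Real.hasDerivAt_sin x).mul (Real.hasDerivAt_cos x)).const_mul 3)).sub
    ((hasDerivAt_id x).const_mul 15)
  refine h.congr_deriv ?_
  have hs : Real.sin x * -Real.sin x = Real.cos x ^ 2 - 1 := by
    linarith [Real.sin_sq_add_cos_sq x, sq (Real.sin x)]
  rw [hs]
  field_simp
  ring

theorem lt_two_mul_tan_add_sin_sub {x : ℝ} (hx : 0 < x) (hx' : x < π / 2) :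
    15 * x < 2 * Real.tan x + 16 * Real.sin x - 3 * (Real.sin x * Real.cos x) := by
  have hcos {y : ℝ} (hy : y ∈ Set.Ico 0 (π / 2)) : 0 < Real.cos y :=
    Real.cos_pos_of_mem_Ioo ⟨by linarith [hy.1, Real.pi_pos], hy.2⟩
  have hmono := strictMonoOn_of_deriv_pos (convex_Ico 0 (π / 2))
    (fun y hy => (hasDerivAt_two_mul_tan_add_sin_sub
      (hcos hy).ne').continuousAt.continuousWithinAt)
    (fun y hy => by
      have hc := hcos (interior_subset hy)
      rw [interior_Ico] at hy
      rw [(hasDerivAt_two_mul_tan_add_sin_sub hc.ne').deriv]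
      have h1 : 0 < 1 - Real.cos y := by
        have := Real.cos_lt_cos_of_nonneg_of_le_pi_div_two le_rfl hy.2.le hy.1
        rw [Real.cos_zero] at this
        linarith
      positivity)
  have h := hmono ⟨le_rfl, by positivity⟩ ⟨hx.le, hx'⟩ hx
  simp only [Real.tan_zero, Real.sin_zero, mul_zero, zero_mul, add_zero, sub_zero] at h
  linarith

theorem stmt_10 (x : ℝ) (hx : 0 < x) (hx' : x ≤ π / 32) :
    (15 * Real.cos x) / (2 + 16 * Real.cos x - 3 * Real.cos x ^ 2) < Real.sin x / x := by
  have hlt : x < π / 2 := by linarith [Real.pi_pos]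
  have hc : 0 < Real.cos x :=
    Real.cos_pos_of_mem_Ioo ⟨by linarith [Real.pi_pos], hlt⟩
  have hden : 0 < 2 + 16 * Real.cos x - 3 * Real.cos x ^ 2 := by
    nlinarith [Real.cos_le_one x]
  have h := mul_lt_mul_of_pos_right (lt_two_mul_tan_add_sin_sub hx hlt) hc
  rw [div_lt_div_iff₀ hden hx]
  have ht := Real.tan_mul_cos hc.ne'
  linear_combination h + 2 * ht
end

section
/- For all real x > 0, x > (1/3)·(8·sin(x/2) − sin x). Equivalently, with π_n = n·sin(π/n) the perimeter of a regular n-gon inscribed in a circle of perimeter π, one has π > (1/3)·(4·π_{2n} − π_n) for every n ≥ 3. -/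
open Real

/-- The derivative of `3 t - 8 sin (t / 2) + sin t` is `2 (1 - cos (t / 2)) ^ 2`. -/
theorem hasDerivAt_three_mul_sub_eight_sin_half_add_sin (t : ℝ) :
    HasDerivAt (fun t : ℝ => 3 * t - 8 * Real.sin (t / 2) + Real.sin t)
      (2 * (1 - Real.cos (t / 2)) ^ 2) t := by
  have h := (((hasDerivAt_id t).const_mul 3).sub
    (((hasDerivAt_id t).div_const 2).sin.const_mul 8)).add (Real.hasDerivAt_sin t)
  have hc : Real.cos t = 2 * Real.cos (t / 2) ^ 2 - 1 := by
    rw [← Real.cos_two_mul, mul_div_cancel₀ t two_ne_zero]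
  refine h.congr_deriv ?_
  rw [hc]
  simp only [id]
  ring

theorem eight_sin_half_sub_sin_lt {x : ℝ} (hx : 0 < x) :
    8 * Real.sin (x / 2) - Real.sin x < 3 * x := by
  rcases le_or_gt x 4 with hx4 | hx4
  · have hmono : StrictMonoOn (fun t : ℝ => 3 * t - 8 * Real.sin (t / 2) + Real.sin t)
        (Set.Icc 0 4) := by
      refine strictMonoOn_of_deriv_pos (convex_Icc 0 4) (by fun_prop) fun t ht => ?_
      rw [interior_Icc] at ht
      rw [(hasDerivAt_three_mul_sub_eight_sin_half_add_sin t).deriv]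
      have hcos : Real.cos (t / 2) < 1 := by
        rw [← Real.cos_zero]
        exact Real.cos_lt_cos_of_nonneg_of_le_pi le_rfl
          (by linarith [ht.2, Real.pi_gt_three]) (by linarith [ht.1])
      have : 0 < 1 - Real.cos (t / 2) := by linarith
      positivity
    have h := hmono ⟨le_rfl, by norm_num⟩ ⟨hx.le, hx4⟩ hx
    norm_num at h
    linarith
  · linarith [Real.sin_le_one (x / 2), Real.neg_one_le_sin x]

theorem stmt_11 :
    (∀ x : ℝ, 0 < x → x > (1 / 3) * (8 * Real.sin (x / 2) - Real.sin x)) ∧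
    (∀ n : ℕ, 3 ≤ n →
      π > (1 / 3) * (4 * ((2 * n : ℝ) * Real.sin (π / (2 * n))) - (n : ℝ) * Real.sin (π / n))) := by
  refine ⟨fun x hx => by linarith [eight_sin_half_sub_sin_lt hx], fun n hn => ?_⟩
  have hn0 : (0 : ℝ) < n := by exact_mod_cast (by omega : 0 < n)
  have h := mul_lt_mul_of_pos_left
    (eight_sin_half_sub_sin_lt (div_pos Real.pi_pos hn0)) hn0
  have hhalf : π / n / 2 = π / (2 * n) := by rw [div_div, mul_comm (n : ℝ)]
  have hpi : (n : ℝ) * (3 * (π / n)) = 3 * π := by field_simp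
  rw [hhalf, hpi] at h
  linarith
end

section
/- For all real x with 0 < x < π/2, x < (2/3)·sin x + (1/3)·tan x. Equivalently, with π_n = n·sin(π/n) and Π_n = n·tan(π/n) the perimeters of the inscribed and circumscribed regular n-gons for a circle of perimeter π, one has π < (2/3)·π_n + (1/3)·Π_n for every n ≥ 3. -/
open Real

theorem hasDerivAt_snellHuygens {x : ℝ} (hx : Real.cos x ≠ 0) :
    HasDerivAt (fun y : ℝ => (2 / 3) * Real.sin y + (1 / 3) * Real.tan y - y)
      ((1 - Real.cos x) ^ 2 * (2 * Real.cos x + 1) / (3 * Real.cos x ^ 2)) x := by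
  convert! (((Real.hasDerivAt_sin x).const_mul (2 / 3)).add
    ((Real.hasDerivAt_tan hx).const_mul (1 / 3))).sub (hasDerivAt_id x) using 1
  field_simp
  ring

theorem lt_two_thirds_sin_add_third_tan {x : ℝ} (hx : 0 < x) (hx' : x < π / 2) :
    x < (2 / 3) * Real.sin x + (1 / 3) * Real.tan x := by
  have cos_pos {y : ℝ} (hy : y ∈ Set.Ico 0 (π / 2)) : 0 < Real.cos y :=
    Real.cos_pos_of_mem_Ioo ⟨by linarith [hy.1, Real.pi_pos], hy.2⟩
  have mono : StrictMonoOn (fun y : ℝ => (2 / 3) * Real.sin y + (1 / 3) * Real.tan y - y)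
      (Set.Ico 0 (π / 2)) := by
    refine strictMonoOn_of_deriv_pos (convex_Ico 0 (π / 2))
      (fun y hy => (hasDerivAt_snellHuygens (cos_pos hy).ne').continuousAt.continuousWithinAt)
      fun y hy => ?_
    rw [interior_Ico] at hy
    have hc := cos_pos (Set.Ioo_subset_Ico_self hy)
    have hlt : Real.cos y < 1 := by
      simpa using Real.cos_lt_cos_of_nonneg_of_le_pi_div_two le_rfl hy.2.le hy.1
    rw [(hasDerivAt_snellHuygens hc.ne').deriv]
    have := sub_pos.2 hlt
    positivity
  simpa using mono ⟨le_rfl, by positivity⟩ ⟨hx.le, hx'⟩ hx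

theorem stmt_12 :
    (∀ x : ℝ, 0 < x → x < π / 2 → x < (2 / 3) * Real.sin x + (1 / 3) * Real.tan x) ∧
    (∀ n : ℕ, 3 ≤ n →
      π < (2 / 3) * ((n : ℝ) * Real.sin (π / n)) + (1 / 3) * ((n : ℝ) * Real.tan (π / n))) := by
  refine ⟨fun x => lt_two_thirds_sin_add_third_tan, fun n hn => ?_⟩
  have hn' : (3 : ℝ) ≤ n := by exact_mod_cast hn
  have hn0 : (0 : ℝ) < n := by linarith
  have h := lt_two_thirds_sin_add_third_tan (x := π / n) (by positivity)
    (div_lt_div_of_pos_left Real.pi_pos two_pos (by linarith))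
  calc π = n * (π / n) := by field_simp
    _ < n * ((2 / 3) * Real.sin (π / n) + (1 / 3) * Real.tan (π / n)) := by gcongr
    _ = _ := by ring
end

section
/- For all real x > 0, (sin x)/x < (2 + cos x)/3; that is, Snell's approximation (the first convergent of the continued fraction expansion of sin x / x) is larger than the true value. -/
open Real

theorem mul_sin_lt_two_mul_one_sub_cos {x : ℝ} (h0 : 0 < x) (hπ : x < π) :
    x * Real.sin x < 2 * (1 - Real.cos x) := by
  obtain ⟨t, rfl⟩ : ∃ t, x = 2 * t := ⟨x / 2, by ring⟩
  have hs : 0 < Real.sin t := Real.sin_pos_of_pos_of_lt_pi (by linarith) (by linarith)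
  have hc : 0 < Real.cos t := Real.cos_pos_of_mem_Ioo ⟨by linarith, by linarith⟩
  have ht : t * Real.cos t < Real.sin t := by
    have := Real.lt_tan (x := t) (by linarith) (by linarith)
    rwa [Real.tan_eq_sin_div_cos, lt_div_iff₀ hc] at this
  rw [Real.sin_two_mul, Real.cos_two_mul]
  nlinarith [mul_lt_mul_of_pos_left ht hs, Real.sin_sq_add_cos_sq t]

theorem three_mul_sin_lt_mul_two_add_cos {x : ℝ} (h0 : 0 < x) :
    3 * Real.sin x < x * (2 + Real.cos x) := by
  rcases lt_or_ge 3 x with h3 | h3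
  · nlinarith [Real.sin_le_one x, Real.neg_one_le_cos x]
  have hd (y : ℝ) : HasDerivAt (fun y ↦ y * (2 + Real.cos y) - 3 * Real.sin y)
      (2 * (1 - Real.cos y) - y * Real.sin y) y := by
    refine (((hasDerivAt_id' y).fun_mul ((Real.hasDerivAt_cos y).const_add 2)).fun_sub
      ((Real.hasDerivAt_sin y).const_mul 3)).congr_deriv ?_
    ring
  have hmono : StrictMonoOn (fun y ↦ y * (2 + Real.cos y) - 3 * Real.sin y)
      (Set.Icc 0 3) := by
    refine strictMonoOn_of_deriv_pos (convex_Icc 0 3) (by fun_prop) fun y hy ↦ ?_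
    rw [interior_Icc] at hy
    rw [(hd y).deriv, sub_pos]
    exact mul_sin_lt_two_mul_one_sub_cos hy.1 (hy.2.trans Real.pi_gt_three)
  have := hmono (by simp) ⟨h0.le, h3⟩ h0
  simp only [zero_mul, Real.sin_zero, mul_zero, sub_zero, sub_pos] at this
  exact this

theorem stmt_13 (x : ℝ) (hx : 0 < x) :
    Real.sin x / x < (2 + Real.cos x) / 3 := by
  rw [div_lt_div_iff₀ hx three_pos]
  linarith [three_mul_sin_lt_mul_two_add_cos hx]
end

section
/- For all real x with 0 < x ≤ π/2, (sin x)/x < (9 + 6·cos x)/(14 + cos x); that is, Newton's approximation (the second convergent of the continued fraction expansion of sin x / x) is larger than the true value. -/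
open Real

/-- The gap between `x` and `sin x * (14 + cos x) / (9 + 6 * cos x)` has a derivative which is
nonnegative. -/
theorem hasDerivAt_sub_sin_mul_div (x : ℝ) (h : 9 + 6 * cos x ≠ 0) :
    HasDerivAt (fun y : ℝ => y - sin y * (14 + cos y) / (9 + 6 * cos y))
      (6 * (1 - cos x) ^ 3 / (9 + 6 * cos x) ^ 2) x := by
  have hnum := (hasDerivAt_sin x).fun_mul ((hasDerivAt_cos x).const_add 14)
  have hden := ((hasDerivAt_cos x).const_mul 6).const_add 9
  refine ((hasDerivAt_id' x).fun_sub (hnum.fun_div hden h)).congr_deriv ?_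
  rw [eq_div_iff (pow_ne_zero 2 h), sub_mul, div_mul_cancel₀ _ (pow_ne_zero 2 h)]
  linear_combination -75 * sin_sq_add_cos_sq x

theorem stmt_15 (x : ℝ) (hx : 0 < x) (hx' : x ≤ π / 2) :
    Real.sin x / x < (9 + 6 * Real.cos x) / (14 + Real.cos x) := by
  have hpos : ∀ y ∈ Set.Icc 0 (π / 2), 0 < 9 + 6 * cos y := fun y hy => by
    have := cos_nonneg_of_neg_pi_div_two_le_of_le (by linarith [hy.1, pi_pos]) hy.2
    linarith
  have hmono : StrictMonoOn (fun y : ℝ => y - sin y * (14 + cos y) / (9 + 6 * cos y))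
      (Set.Icc 0 (π / 2)) := by
    refine strictMonoOn_of_deriv_pos (convex_Icc _ _)
      (fun y hy => (hasDerivAt_sub_sin_mul_div y
        (hpos y hy).ne').continuousAt.continuousWithinAt) fun y hy => ?_
    have hd := hpos y (interior_subset hy)
    rw [interior_Icc] at hy
    rw [(hasDerivAt_sub_sin_mul_div y hd.ne').deriv]
    have hcos : cos y < 1 := by
      simpa using cos_lt_cos_of_nonneg_of_le_pi_div_two le_rfl hy.2.le hy.1
    have : 0 < 1 - cos y := sub_pos.2 hcos
    positivity
  have hgap := hmono ⟨le_rfl, hx.le.trans hx'⟩ ⟨hx.le, hx'⟩ hx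
  simp only [sin_zero, zero_mul, zero_div, sub_zero, sub_pos] at hgap
  rw [div_lt_iff₀ (hpos x ⟨hx.le, hx'⟩)] at hgap
  rw [div_lt_div_iff₀ hx (by linarith [neg_one_le_cos x])]
  linarith
end

section
/- The limit as x tends to 0 of ((sin x)/x − (9 + 6·cos x)/(14 + cos x))/x^6 equals −1/2100. -/
open Real Filter

/-- The degree seven Taylor expansion of `sin` at `0`, as a limit. -/
theorem tendsto_sin_sub_taylor_div_pow_seven :
    Tendsto (fun x : ℝ => (sin x - (x - x ^ 3 / 6 + x ^ 5 / 120 - x ^ 7 / 5040)) / x ^ 7)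
      (nhds 0) (nhds 0) := by
  have h := Real.taylor_tendsto (f := sin) (x₀ := 0) (n := 7) convex_univ (Set.mem_univ 0)
    contDiff_sin.contDiffOn
  rw [nhdsWithin_univ] at h
  refine h.congr fun x => ?_
  simp [taylorWithinEval_succ, taylor_within_zero_eval, iteratedDerivWithin_univ, Nat.factorial]
  ring

/-- The degree six Taylor expansion of `cos` at `0`, as a limit. -/
theorem tendsto_cos_sub_taylor_div_pow_six :
    Tendsto (fun x : ℝ => (cos x - (1 - x ^ 2 / 2 + x ^ 4 / 24 - x ^ 6 / 720)) / x ^ 6)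
      (nhds 0) (nhds 0) := by
  have h := Real.taylor_tendsto (f := cos) (x₀ := 0) (n := 6) convex_univ (Set.mem_univ 0)
    contDiff_cos.contDiffOn
  rw [nhdsWithin_univ] at h
  refine h.congr fun x => ?_
  simp [taylorWithinEval_succ, taylor_within_zero_eval, iteratedDerivWithin_univ, Nat.factorial]
  ring

theorem stmt_16 :
    Filter.Tendsto
      (fun x : ℝ => (Real.sin x / x - (9 + 6 * Real.cos x) / (14 + Real.cos x)) / x ^ 6)
      (nhdsWithin 0 {0}ᶜ) (nhds (-(1 / 2100))) := by
  have hS := tendsto_sin_sub_taylor_div_pow_seven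
  have hC := tendsto_cos_sub_taylor_div_pow_six
  have hdouble : Tendsto (fun x : ℝ => 2 * x) (nhds 0) (nhds 0) :=
    Continuous.tendsto' (by fun_prop) _ _ (by simp)
  have hden : Tendsto (fun x : ℝ => 14 + cos x) (nhds 0) (nhds 15) :=
    Continuous.tendsto' (by fun_prop) _ _ (by norm_num)
  have key := ((((hS.const_mul 14).add ((hS.comp hdouble).const_mul 64)).sub
    (hC.const_mul 6)).sub_const (1 / 140)).div hden (by norm_num)
  have hlim : (14 * 0 + 64 * 0 - 6 * 0 - 1 / 140) / 15 = (-(1 / 2100) : ℝ) := by norm_num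
  rw [hlim] at key
  refine (key.mono_left nhdsWithin_le_nhds).congr' ?_
  filter_upwards [self_mem_nhdsWithin] with x hx
  have hx : x ≠ 0 := hx
  have hd : 14 + cos x ≠ 0 := by linarith [neg_one_le_cos x]
  simp only [Pi.div_apply, Function.comp_apply, sin_two_mul]
  field_simp
  ring
end

section
/- For all real x with 0 < x ≤ π/2, (sin x)/x < (51 + 48·cos x + 6·cos^2 x)/(80 + 25·cos x); that is, the third convergent of the continued fraction expansion of sin x / x is larger than the true value. -/
open Real

/-- The difference `x - sin x * q / p` for the third convergent `p / q` of `sin x / x`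
has derivative `36 (1 - cos x)⁴ / p²`. -/
theorem hasDerivAt_sub_sin_mul_convergent (y : ℝ)
    (hp : 51 + 48 * cos y + 6 * cos y ^ 2 ≠ 0) :
    HasDerivAt
      (fun x => x - sin x * (80 + 25 * cos x) / (51 + 48 * cos x + 6 * cos x ^ 2))
      (36 * (1 - cos y) ^ 4 / (51 + 48 * cos y + 6 * cos y ^ 2) ^ 2) y := by
  have hs := hasDerivAt_sin y
  have hc := hasDerivAt_cos y
  have hq := (hc.const_mul 25).const_add 80
  have hd := ((hc.const_mul 48).const_add 51).add ((hc.pow 2).const_mul 6)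
  refine ((hasDerivAt_id y).sub ((hs.mul hq).div hd hp)).congr_deriv ?_
  simp only [Pi.mul_apply, Pi.add_apply, Pi.pow_apply]
  symm
  rw [eq_sub_iff_add_eq, ← add_div, div_eq_one_iff_eq (pow_ne_zero 2 hp)]
  push_cast
  linear_combination
    -(25 * (51 + 48 * cos y + 6 * cos y ^ 2) - (80 + 25 * cos y) * (48 + 12 * cos y)) *
      sin_sq_add_cos_sq y

theorem stmt_17 (x : ℝ) (hx : 0 < x) (hx' : x ≤ π / 2) :
    Real.sin x / x <
      (51 + 48 * Real.cos x + 6 * Real.cos x ^ 2) / (80 + 25 * Real.cos x) := by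
  have hcos : ∀ y ∈ Set.Icc 0 x, 0 ≤ cos y := fun y hy =>
    cos_nonneg_of_mem_Icc ⟨by linarith [hy.1, pi_pos], hy.2.trans hx'⟩
  have hp : ∀ y ∈ Set.Icc 0 x, 0 < 51 + 48 * cos y + 6 * cos y ^ 2 := fun y hy => by
    have := hcos y hy
    positivity
  have hderiv := fun y hy => hasDerivAt_sub_sin_mul_convergent y (hp y hy).ne'
  have hmono := strictMonoOn_of_deriv_pos (convex_Icc 0 x)
    (fun y hy => (hderiv y hy).continuousAt.continuousWithinAt) fun y hy => by
      have hy' := interior_subset hy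
      rw [interior_Icc] at hy
      rw [(hderiv y hy').deriv]
      have hlt : cos y < 1 := by
        simpa using cos_lt_cos_of_nonneg_of_le_pi_div_two le_rfl (hy.2.le.trans hx') hy.1
      have := sub_pos.2 hlt
      have := hp y hy'
      positivity
  have hx_mem : x ∈ Set.Icc 0 x := ⟨hx.le, le_rfl⟩
  have hpos := hmono ⟨le_rfl, hx.le⟩ hx_mem hx
  simp only [sin_zero, zero_mul, zero_div, sub_zero, sub_pos, div_lt_iff₀ (hp x hx_mem)] at hpos
  have hq : 0 < 80 + 25 * cos x := by linarith [hcos x hx_mem]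
  rw [div_lt_div_iff₀ hx hq]
  linarith
end

section
/- The limit as x tends to 0 of ((sin x)/x − (51 + 48·cos x + 6·cos^2 x)/(80 + 25·cos x))/x^8 equals −1/44100. -/
open Real Filter

/-- Taylor expansion of `exp (x * I)` along the real line, with little-o remainder. -/
lemma exp_mul_I_sub_sum_range_isLittleO_pow (n : ℕ) :
    (fun x : ℝ => Complex.exp (x * Complex.I)
      - ∑ i ∈ Finset.range (n + 1), ((x : ℂ) * Complex.I) ^ i / (i.factorial : ℂ))
      =o[nhds 0] (fun x : ℝ => x ^ n) := by
  have ht : Tendsto (fun x : ℝ => (x : ℂ) * Complex.I) (nhds 0) (nhds 0) := by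
    have : Continuous (fun x : ℝ => (x : ℂ) * Complex.I) := by fun_prop
    simpa using this.tendsto 0
  have h := (Complex.exp_sub_sum_range_succ_isLittleO_pow n).comp_tendsto ht
  refine h.trans_isBigO (Asymptotics.IsBigO.of_bound 1 (Eventually.of_forall fun x => ?_))
  simp

lemma sin_taylor_nine_isLittleO :
    (fun x : ℝ => sin x - (x - x ^ 3 / 6 + x ^ 5 / 120 - x ^ 7 / 5040 + x ^ 9 / 362880))
      =o[nhds 0] (fun x : ℝ => x ^ 9) := by
  refine Asymptotics.IsBigO.trans_isLittleO (.of_bound 1 (Eventually.of_forall fun x => ?_))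
    (exp_mul_I_sub_sum_range_isLittleO_pow 9)
  rw [one_mul]
  refine le_trans (le_of_eq ?_) (Complex.abs_im_le_norm _)
  rw [Real.norm_eq_abs, Complex.sub_im, Complex.exp_ofReal_mul_I_im]
  congr 2
  have : ∑ i ∈ Finset.range (9 + 1), ((x : ℂ) * Complex.I) ^ i / (i.factorial : ℂ)
      = ((1 - x ^ 2 / 2 + x ^ 4 / 24 - x ^ 6 / 720 + x ^ 8 / 40320 : ℝ) : ℂ)
        + ((x - x ^ 3 / 6 + x ^ 5 / 120 - x ^ 7 / 5040 + x ^ 9 / 362880 : ℝ) : ℂ) * Complex.I := by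
    simp only [Finset.sum_range_succ, Finset.sum_range_zero, Nat.factorial, mul_pow,
      Complex.I_pow_eq_pow_mod 4, Complex.I_pow_eq_pow_mod 5, Complex.I_pow_eq_pow_mod 6,
      Complex.I_pow_eq_pow_mod 7, Complex.I_pow_eq_pow_mod 8, Complex.I_pow_eq_pow_mod 9]
    norm_num [Complex.I_pow_three]
    ring
  rw [this, Complex.add_im, Complex.ofReal_im, Complex.im_ofReal_mul, Complex.I_im]
  ring

lemma cos_taylor_eight_isLittleO :
    (fun x : ℝ => cos x - (1 - x ^ 2 / 2 + x ^ 4 / 24 - x ^ 6 / 720 + x ^ 8 / 40320))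
      =o[nhds 0] (fun x : ℝ => x ^ 8) := by
  refine Asymptotics.IsBigO.trans_isLittleO (.of_bound 1 (Eventually.of_forall fun x => ?_))
    (exp_mul_I_sub_sum_range_isLittleO_pow 8)
  rw [one_mul]
  refine le_trans (le_of_eq ?_) (Complex.abs_re_le_norm _)
  rw [Real.norm_eq_abs, Complex.sub_re, Complex.exp_ofReal_mul_I_re]
  congr 2
  have : ∑ i ∈ Finset.range (8 + 1), ((x : ℂ) * Complex.I) ^ i / (i.factorial : ℂ)
      = ((1 - x ^ 2 / 2 + x ^ 4 / 24 - x ^ 6 / 720 + x ^ 8 / 40320 : ℝ) : ℂ)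
        + ((x - x ^ 3 / 6 + x ^ 5 / 120 - x ^ 7 / 5040 : ℝ) : ℂ) * Complex.I := by
    simp only [Finset.sum_range_succ, Finset.sum_range_zero, Nat.factorial, mul_pow,
      Complex.I_pow_eq_pow_mod 4, Complex.I_pow_eq_pow_mod 5, Complex.I_pow_eq_pow_mod 6,
      Complex.I_pow_eq_pow_mod 7, Complex.I_pow_eq_pow_mod 8]
    norm_num [Complex.I_pow_three]
    ring
  rw [this, Complex.add_re, Complex.ofReal_re, Complex.re_ofReal_mul, Complex.I_re]
  ring

theorem stmt_18 :
    Filter.Tendsto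
      (fun x : ℝ =>
        (Real.sin x / x - (51 + 48 * Real.cos x + 6 * Real.cos x ^ 2) / (80 + 25 * Real.cos x))
          / x ^ 8)
      (nhdsWithin 0 {0}ᶜ) (nhds (-(1 / 44100))) := by
  have hd : Tendsto (fun x : ℝ => 2 * x) (nhds 0) (nhds 0) := by
    have : Continuous (fun x : ℝ => 2 * x) := by fun_prop
    simpa using this.tendsto 0
  have hs := sin_taylor_nine_isLittleO.tendsto_div_nhds_zero
  have hc := cos_taylor_eight_isLittleO.tendsto_div_nhds_zero
  have hcos : Tendsto (fun x : ℝ => 80 + 25 * cos x) (nhds 0) (nhds 105) := by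
    have : Continuous (fun x : ℝ => 80 + 25 * cos x) := by fun_prop
    convert this.tendsto 0 using 2
    norm_num
  have key := (((((hs.const_mul 80).add ((hs.comp hd).const_mul 6400)).sub
    (hc.const_mul 48)).sub ((hc.comp hd).const_mul 768)).sub_const (1 / 420)).div hcos
    (by norm_num)
  have hval : (80 * 0 + 6400 * 0 - 48 * 0 - 768 * 0 - 1 / 420 : ℝ) / 105 = -(1 / 44100) := by
    norm_num
  rw [hval] at key
  refine (key.mono_left nhdsWithin_le_nhds).congr' ?_
  filter_upwards [self_mem_nhdsWithin] with x hx
  have hx0 : x ≠ 0 := hx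
  have hne : 80 + 25 * cos x ≠ 0 := ne_of_gt (by linarith [neg_one_le_cos x])
  simp only [Function.comp_apply, Pi.div_apply, sin_two_mul, cos_two_mul]
  rw [div_sub_div _ _ hx0 hne, div_div,
    div_eq_div_iff hne (mul_ne_zero (mul_ne_zero hx0 hne) (pow_ne_zero 8 hx0))]
  field_simp
  ring
end
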